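/- For every integer M ≥ 3 and every positive integer k, and every complex number s with q_M·k + (M+1)·log 3 ≤ Re(s) ≤ q_{M−1}·k − M·log 3, the k-th derivative of the Riemann zeta function does not vanish at s, i.e. iteratedDeriv k riemannZeta s ≠ 0. -/

import Mathlib

/-- `q M = log(log M / log(M+1)) / log(M/(M+1))`, the slope of the `M`-th critical line. -/
noncomputable def q (M : ℕ) : ℝ :=
  Real.log (Real.log M / Real.log ((M : ℝ) + 1)) / Real.log ((M : ℝ) / ((M : ℝ) + 1))

open Real in
lemma q_eq (m : ℕ) (hm : 2 ≤ m) :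
    q m = (log (log ((m : ℝ) + 1)) - log (log m)) / (log ((m : ℝ) + 1) - log m) := by
  have h2 : (2 : ℝ) ≤ m := by exact_mod_cast hm
  have hl : 0 < log (m : ℝ) := log_pos (by linarith)
  have hl1 : 0 < log ((m : ℝ) + 1) := log_pos (by linarith)
  unfold q
  rw [log_div hl.ne' hl1.ne', log_div (by positivity) (by positivity), ← neg_sub, ← neg_sub (log ((m:ℝ)+1)),
    neg_div_neg_eq]

open Real in
lemma concave_up (m n : ℕ) (hm : 2 ≤ m) (hmn : m ≤ n) :
    log (log n) - log (log m) ≤ q m * (log n - log m) := by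
  have h2 : (2 : ℝ) ≤ m := by exact_mod_cast hm
  have hl : 0 < log (m : ℝ) := log_pos (by linarith)
  have hlt : log (m : ℝ) < log ((m : ℝ) + 1) := log_lt_log (by linarith) (by linarith)
  have hd : q m * (log ((m : ℝ) + 1) - log m) = log (log ((m : ℝ) + 1)) - log (log m) := by
    rw [q_eq m hm, div_mul_cancel₀]
    linarith
  rcases Nat.eq_or_lt_of_le hmn with rfl | h
  · simp
  rcases Nat.eq_or_lt_of_le (Nat.succ_le_of_lt h) with rfl | h'
  · push_cast
    exact hd.ge
  · have h3 : (m : ℝ) + 1 < n := by exact_mod_cast h'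
    have hlt2 : log ((m : ℝ) + 1) < log n := log_lt_log (by linarith) h3
    have := strictConcaveOn_log_Ioi.concaveOn.slope_anti_adjacent (x := log m)
      (y := log ((m : ℝ) + 1)) (z := log n) (Set.mem_Ioi.2 hl) (Set.mem_Ioi.2 (by linarith)) hlt hlt2
    rw [← q_eq m hm, div_le_iff₀ (by linarith)] at this
    linarith

open Real in
lemma concave_down (m n : ℕ) (hn : 2 ≤ n) (hmn : n ≤ m + 1) :
    log (log n) - log (log ((m : ℝ) + 1)) ≤ q m * (log n - log ((m : ℝ) + 1)) := by
  have h2 : (2 : ℝ) ≤ n := by exact_mod_cast hn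
  have hl : 0 < log (n : ℝ) := log_pos (by linarith)
  rcases Nat.eq_or_lt_of_le hmn with rfl | h
  · simp
  have hnm : n ≤ m := by omega
  have hm : 2 ≤ m := by omega
  have h2 : (2 : ℝ) ≤ m := by exact_mod_cast hm
  have hlt : log (m : ℝ) < log ((m : ℝ) + 1) := log_lt_log (by linarith) (by linarith)
  have hd : q m * (log ((m : ℝ) + 1) - log m) = log (log ((m : ℝ) + 1)) - log (log m) := by
    rw [q_eq m hm, div_mul_cancel₀]
    linarith
  rcases Nat.eq_or_lt_of_le hnm with rfl | h'
  · linarith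
  · have h3 : (n : ℝ) < m := by exact_mod_cast h'
    have hlt2 : log (n : ℝ) < log m := log_lt_log (by linarith) h3
    have := strictConcaveOn_log_Ioi.concaveOn.slope_anti_adjacent (x := log n)
      (y := log (m : ℝ)) (z := log ((m : ℝ) + 1)) (Set.mem_Ioi.2 hl) (Set.mem_Ioi.2 (by linarith)) hlt2 hlt
    rw [← q_eq m hm, le_div_iff₀ (by linarith)] at this
    linarith

/-- The size of the `n`-th term of the Dirichlet series of the `k`-th derivative. -/
noncomputable def F (k : ℕ) (σ : ℝ) (n : ℕ) : ℝ :=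
  Real.exp (k * Real.log (Real.log n) - σ * Real.log n)

open Real in
lemma F_up (k : ℕ) (σ c : ℝ) (m n : ℕ) (hm : 2 ≤ m) (hmn : m ≤ n) (h : c ≤ σ - q m * k) :
    F k σ n ≤ F k σ m * exp (-(c * (log n - log m))) := by
  unfold F
  rw [← exp_add, exp_le_exp]
  have h1 := concave_up m n hm hmn
  have h2 : (2 : ℝ) ≤ m := by exact_mod_cast hm
  have h3 : (m : ℝ) ≤ n := by exact_mod_cast hmn
  have h4 : log (m : ℝ) ≤ log n := log_le_log (by linarith) h3
  have h5 := mul_le_mul_of_nonneg_left h1 (Nat.cast_nonneg (α := ℝ) k)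
  have h6 := mul_le_mul_of_nonneg_right h (sub_nonneg.2 h4)
  linarith

open Real in
lemma F_down (k : ℕ) (σ c : ℝ) (m n : ℕ) (hn : 2 ≤ n) (hmn : n ≤ m + 1) (h : c ≤ q m * k - σ) :
    F k σ n ≤ F k σ (m + 1) * exp (-(c * (log ((m : ℝ) + 1) - log n))) := by
  unfold F
  rw [← exp_add, exp_le_exp]
  have h1 := concave_down m n hn hmn
  have h2 : (2 : ℝ) ≤ n := by exact_mod_cast hn
  have h3 : (n : ℝ) ≤ m + 1 := by exact_mod_cast hmn
  have h4 : log (n : ℝ) ≤ log ((m : ℝ) + 1) := log_le_log (by linarith) h3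
  have h5 := mul_le_mul_of_nonneg_left h1 (Nat.cast_nonneg (α := ℝ) k)
  have h6 := mul_le_mul_of_nonneg_right h (sub_nonneg.2 h4)
  push_cast
  linarith

open Real in
lemma q_lower (m : ℕ) (hm : 2 ≤ m) : 2 / (log m + log ((m : ℝ) + 1)) ≤ q m := by
  have h2 : (2 : ℝ) ≤ m := by exact_mod_cast hm
  have hl : 0 < log (m : ℝ) := log_pos (by linarith)
  have hlt : log (m : ℝ) < log ((m : ℝ) + 1) := log_lt_log (by linarith) (by linarith)
  rw [q_eq m hm]
  set x := log (m : ℝ)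
  set y := log ((m : ℝ) + 1)
  have hy : 0 < y := by linarith
  have h := le_log_one_add_of_nonneg (x := y / x - 1) (by rw [sub_nonneg, le_div_iff₀ hl]; linarith)
  rw [show 1 + (y / x - 1) = y / x by ring, log_div hy.ne' hl.ne'] at h
  rw [le_div_iff₀ (by linarith)]
  refine le_trans (le_of_eq ?_) h
  have : y / x - 1 + 2 = (x + y) / x := by field_simp; ring
  rw [this]
  field_simp

open Real in
lemma q_upper (m : ℕ) (hm : 2 ≤ m) : q m ≤ (1 / log m + 1 / log ((m : ℝ) + 1)) / 2 := by
  have h2 : (2 : ℝ) ≤ m := by exact_mod_cast hm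
  have hl : 0 < log (m : ℝ) := log_pos (by linarith)
  have hlt : log (m : ℝ) < log ((m : ℝ) + 1) := log_lt_log (by linarith) (by linarith)
  rw [q_eq m hm]
  set x := log (m : ℝ)
  set y := log ((m : ℝ) + 1)
  have hy : 0 < y := by linarith
  have hyx : 0 < y / x := by positivity
  have h : log (y / x) ≤ sinh (log (y / x)) :=
    self_le_sinh_iff.2 (log_nonneg (by rw [le_div_iff₀ hl]; linarith))
  rw [sinh_log hyx, log_div hy.ne' hl.ne'] at h
  rw [div_le_iff₀ (by linarith)]
  refine h.trans (le_of_eq ?_)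
  field_simp
  ring

lemma rat_ineq (d x : ℝ) (hd : 0 < d) (hx : 5 * d ≤ x) :
    3 / 2 * (1 / (x + d) + 1 / (x + 7 / 4 * d)) + 1 / 2 * (1 / (x - 4 / 3 * d) + 1 / x)
      ≤ 8 / (2 * x + d) := by
  obtain ⟨u, hu, rfl⟩ : ∃ u, 0 ≤ u ∧ x = 5 * d + u := ⟨x - 5 * d, by linarith, by ring⟩
  have h1 : 5 * d + u - 4 / 3 * d = (11 * d + 3 * u) / 3 := by ring
  have h2 : 5 * d + u + 7 / 4 * d = (27 * d + 4 * u) / 4 := by ring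
  rw [h1, h2, ← sub_nonneg]
  have key : 8 / (2 * (5 * d + u) + d) - (3 / 2 * (1 / (5 * d + u + d) + 1 / ((27 * d + 4 * u) / 4)) +
    1 / 2 * (1 / ((11 * d + 3 * u) / 3) + 1 / (5 * d + u)))
    = (16 * (6 * d + u) * (27 * d + 4 * u) * (11 * d + 3 * u) * (5 * d + u)
       - (11 * d + 2 * u) * (3 * ((27 * d + 4 * u) + 4 * (6 * d + u)) * (11 * d + 3 * u) * (5 * d + u)
         + (3 * (5 * d + u) + (11 * d + 3 * u)) * (6 * d + u) * (27 * d + 4 * u)))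
      / (2 * (11 * d + 2 * u) * (6 * d + u) * (27 * d + 4 * u) * (11 * d + 3 * u) * (5 * d + u)) := by
    have : 2 * (5 * d + u) + d = 11 * d + 2 * u := by ring
    have h6 : 5 * d + u + d = 6 * d + u := by ring
    rw [this, h6]
    field_simp
    ring
  rw [key]
  apply div_nonneg _ (by positivity)
  ring_nf
  positivity

open Real in
lemma log_pow_cmp (a b c : ℝ) (i j : ℕ) (ha : 0 < a) (hb : 0 < b) (hc : 0 < c)
    (h : b ^ (i + j) ≤ a ^ i * c ^ j) : ((i : ℝ) + j) * log b ≤ i * log a + j * log c := by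
  have := log_le_log (by positivity) h
  rw [log_mul (by positivity) (by positivity), log_pow, log_pow, log_pow] at this
  push_cast at this
  exact this

open Real in
lemma q_conv (M : ℕ) (hM : 4 ≤ M) : q (M - 1) - q M ≤ 3 * (q M - q (M + 1)) := by
  obtain ⟨N, rfl⟩ : ∃ N, M = N + 4 := ⟨M - 4, by omega⟩
  have h1 := q_upper (N + 3) (by omega)
  have h2 := q_lower (N + 4) (by omega)
  have h3 := q_upper (N + 4 + 1) (by omega)
  rw [show N + 4 - 1 = N + 3 by omega]
  push_cast at h1 h2 h3
  have hN : (0 : ℝ) ≤ N := Nat.cast_nonneg N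
  generalize (N : ℝ) = t at *
  rw [show t + 3 + 1 = t + 4 by ring] at h1
  rw [show t + 4 + 1 = t + 5 by ring] at *
  rw [show t + 5 + 1 = t + 6 by ring] at *
  have e1 := log_pow_cmp (t + 6) (t + 5) (t + 4) 4 3 (by linarith) (by linarith) (by linarith)
    (by rw [← sub_nonneg]; ring_nf; positivity)
  have e2 := log_pow_cmp (t + 5) (t + 4) (t + 3) 4 3 (by linarith) (by linarith) (by linarith)
    (by rw [← sub_nonneg]; ring_nf; positivity)
  push_cast at e1 e2
  have e3 : log (t + 5) - log (t + 4) ≤ 1 / 4 := by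
    rw [← log_div (by linarith) (by linarith)]
    refine (log_le_sub_one_of_pos (by positivity)).trans ?_
    rw [sub_le_iff_le_add, div_le_iff₀ (by linarith)]
    linarith
  have e4 : 5 / 4 ≤ log (t + 4) := by
    have : log 4 ≤ log (t + 4) := log_le_log (by norm_num) (by linarith)
    have h4 : log 4 = 2 * log 2 := by
      rw [show (4 : ℝ) = 2 ^ 2 by norm_num, log_pow]; norm_num
    have := log_two_gt_d9
    linarith
  have e5 : 0 < log (t + 5) - log (t + 4) := sub_pos.2 (log_lt_log (by linarith) (by linarith))
  have r := rat_ineq _ (log (t + 4)) e5 (by linarith)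
  set x := log (t + 4)
  set y := log (t + 5)
  set z := log (t + 6)
  set w := log (t + 3)
  have g1 : 1 / z ≤ 1 / (x + 7 / 4 * (y - x)) :=
    one_div_le_one_div_of_le (by linarith) (by linarith)
  have g2 : 1 / w ≤ 1 / (x - 4 / 3 * (y - x)) :=
    one_div_le_one_div_of_le (by linarith) (by linarith)
  rw [show x + (y - x) = y by ring, show 2 * x + (y - x) = x + y by ring] at r
  have g3 : 8 / (x + y) = 4 * (2 / (x + y)) := by ring
  linarith

open Real in
lemma tail_step (c x l : ℝ) (hc : 1 < c) (hx : 1 ≤ x) :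
    exp (-(c * (log (x + 1) - l))) ≤
      x / (c - 1) * exp (-(c * (log x - l))) - (x + 1) / (c - 1) * exp (-(c * (log (x + 1) - l))) := by
  have hx0 : 0 < x := by linarith
  have hD : 1 / (x + 1) ≤ log (x + 1) - log x := by
    have h := one_sub_inv_le_log_of_pos (x := (x + 1) / x) (by positivity)
    rw [log_div (by positivity) (by positivity)] at h
    refine le_trans (le_of_eq ?_) h
    field_simp
    ring
  have h1 : exp (-(c * (log x - l))) =
      exp (-(c * (log (x + 1) - l))) * ((x + 1) / x * exp ((c - 1) * (log (x + 1) - log x))) := by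
    have : (x + 1) / x = exp (log (x + 1) - log x) := by
      rw [exp_sub, exp_log (by positivity), exp_log hx0]
    rw [this, ← exp_add, ← exp_add]
    congr 1
    ring
  have h2 : 1 + (c - 1) * (1 / (x + 1)) ≤ exp ((c - 1) * (log (x + 1) - log x)) := by
    have := add_one_le_exp ((c - 1) * (log (x + 1) - log x))
    have h3 := mul_le_mul_of_nonneg_left hD (show 0 ≤ c - 1 by linarith)
    linarith
  rw [h1]
  set E := exp (-(c * (log (x + 1) - l)))
  have hE : 0 < E := exp_pos _
  set G := exp ((c - 1) * (log (x + 1) - log x))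
  have hc' : 0 < c - 1 := by linarith
  have h4 : x + 1 + (c - 1) ≤ (x + 1) * G := by
    calc x + 1 + (c - 1) = (x + 1) * (1 + (c - 1) * (1 / (x + 1))) := by field_simp
      _ ≤ _ := by gcongr
  have h5 : x / (c - 1) * (E * ((x + 1) / x * G)) - (x + 1) / (c - 1) * E
      = E * (((x + 1) * G - (x + 1)) / (c - 1)) := by
    field_simp
  rw [h5]
  apply le_mul_of_one_le_right hE.le
  rw [le_div_iff₀ hc']
  linarith

open Real in
lemma tail_bound (b : ℕ → ℝ) (A c : ℝ) (N : ℕ) (hN : 1 ≤ N) (hc : 1 < c) (hA : 0 ≤ A)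
    (hb : ∀ n, 0 ≤ b n)
    (h : ∀ n : ℕ, b n ≤ A * exp (-(c * (log ((N : ℝ) + n + 1) - log N)))) :
    ∑' n, b n ≤ A * (N / (c - 1)) := by
  have hN' : (1 : ℝ) ≤ N := by exact_mod_cast hN
  have hc' : 0 < c - 1 := by linarith
  refine Real.tsum_le_of_sum_range_le hb fun n => ?_
  have key : ∀ n : ℕ, ∑ i ∈ Finset.range n, b i ≤
      A * (N / (c - 1) - ((N : ℝ) + n) / (c - 1) * exp (-(c * (log ((N : ℝ) + n) - log N)))) := by
    intro n
    induction n with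
    | zero => simp
    | succ n ih =>
      rw [Finset.sum_range_succ]
      have h1 := tail_step c ((N : ℝ) + n) (log N) hc (by linarith [Nat.cast_nonneg (α := ℝ) n])
      have h2 := mul_le_mul_of_nonneg_left h1 hA
      have h3 := h n
      push_cast
      rw [← add_assoc]
      linarith
  refine (key n).trans ?_
  apply mul_le_mul_of_nonneg_left _ hA
  have : 0 ≤ ((N : ℝ) + n) / (c - 1) * exp (-(c * (log ((N : ℝ) + n) - log N))) := by positivity
  linarith

lemma F_pos (k : ℕ) (σ : ℝ) (n : ℕ) : 0 < F k σ n := Real.exp_pos _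

open Real in
lemma dominate (a : ℕ → ℂ) (k : ℕ) (σ : ℝ) (M : ℕ) (hM : 3 ≤ M) (α β γ c : ℝ)
    (hs : Summable a) (ha : ∀ n, 2 ≤ n → ‖a n‖ = F k σ n)
    (hγ : ∑ n ∈ Finset.range M, ‖a n‖ ≤ γ * F k σ M)
    (hα : F k σ (M + 1) ≤ α * F k σ M)
    (hc : 1 < c) (hβ : 0 ≤ β)
    (ht : ∀ n, M + 2 ≤ n → F k σ n ≤
      β * F k σ M * exp (-(c * (log n - log ((M : ℝ) + 2)))))
    (hlt : γ + α + β * (1 + ((M : ℝ) + 2) / (c - 1)) < 1) : ∑' n, a n ≠ 0 := by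
  intro h0
  have hF := F_pos k σ M
  have e1 := hs.sum_add_tsum_nat_add (M + 3)
  rw [h0, Finset.sum_range_succ, Finset.sum_range_succ, Finset.sum_range_succ] at e1
  have hsn : Summable fun n => ‖a (n + (M + 3))‖ :=
    ((summable_nat_add_iff (M + 3)).2 hs).norm
  have e2 : a M = -(∑ n ∈ Finset.range M, a n) - a (M + 1) - a (M + 2) - ∑' n, a (n + (M + 3)) := by
    linear_combination e1
  have e3 : ‖a M‖ ≤ ∑ n ∈ Finset.range M, ‖a n‖ + ‖a (M + 1)‖ + ‖a (M + 2)‖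
      + ∑' n, ‖a (n + (M + 3))‖ := by
    rw [e2]
    refine (norm_sub_le _ _).trans (add_le_add ?_ (norm_tsum_le_tsum_norm hsn))
    refine (norm_sub_le _ _).trans (add_le_add ?_ le_rfl)
    refine (norm_sub_le _ _).trans (add_le_add ?_ le_rfl)
    rw [norm_neg]
    exact norm_sum_le _ _
  have e4 : ∑' n, ‖a (n + (M + 3))‖ ≤ (β * F k σ M) * (((M + 2 : ℕ) : ℝ) / (c - 1)) := by
    apply tail_bound _ _ c (M + 2) (by omega) hc (by positivity) (fun _ => norm_nonneg _)
    intro n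
    rw [ha _ (by omega)]
    have := ht (n + (M + 3)) (by omega)
    push_cast at this ⊢
    rw [show (M : ℝ) + 2 + n + 1 = n + (M + 3) by ring]
    exact this
  have e5 := ht (M + 2) le_rfl
  push_cast at e4 e5
  simp only [sub_self, mul_zero, neg_zero, exp_zero, mul_one] at e5
  rw [ha _ (by omega), ha _ (by omega), ha _ (by omega)] at e3
  have e6 := mul_lt_mul_of_pos_right hlt hF
  linarith

open Real in
lemma exp_log_nat (p : ℕ) (x y : ℝ) (hx : 0 < x) (hy : 0 < y) :
    exp (-((p : ℝ) * (log x - log y))) = (y / x) ^ p := by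
  rw [← log_div hx.ne' hy.ne', ← mul_neg, ← log_inv, inv_div, exp_nat_mul, exp_log (by positivity)]

open Real in
lemma case_three (a : ℕ → ℂ) (k : ℕ) (σ : ℝ)
    (hs : Summable a) (ha : ∀ n, 2 ≤ n → ‖a n‖ = F k σ n) (ha0 : a 0 = 0) (ha1 : a 1 = 0)
    (h1 : 4 ≤ σ - q 3 * k) (h2 : 3 ≤ q 2 * k - σ) : ∑' n, a n ≠ 0 := by
  have hF := F_pos k σ 3
  have hu : ∀ n : ℕ, 3 ≤ n → F k σ n ≤ F k σ 3 * (3 / n) ^ 4 := by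
    intro n hn
    have h := F_up k σ 4 3 n (by norm_num) hn h1
    have := exp_log_nat 4 (n : ℝ) 3 (by positivity) (by norm_num)
    push_cast at h this
    rwa [this] at h
  refine dominate a k σ 3 le_rfl ((3 / 4) ^ 4) ((3 / 5) ^ 4) ((2 / 3) ^ 3) 4 hs ha ?_ ?_
    (by norm_num) (by norm_num) ?_ (by norm_num)
  · rw [Finset.sum_range_succ, Finset.sum_range_succ, Finset.sum_range_succ]
    simp only [Finset.range_zero, Finset.sum_empty, ha0, ha1, norm_zero, zero_add]
    rw [ha 2 le_rfl]
    have h := F_down k σ 3 2 2 le_rfl (by norm_num) h2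
    have := exp_log_nat 3 (3 : ℝ) 2 (by norm_num) (by norm_num)
    push_cast at h this
    rw [show (2 : ℝ) + 1 = 3 by norm_num, this] at h
    linarith
  · have := hu 4 (by norm_num)
    push_cast at this
    linarith
  · intro n hn
    have := hu n (by omega)
    have e := exp_log_nat 4 (n : ℝ) 5 (by positivity) (by norm_num)
    push_cast at e ⊢
    rw [show (3 : ℝ) + 2 = 5 by norm_num, e]
    refine this.trans (le_of_eq ?_)
    have : (n : ℝ) ≠ 0 := by positivity
    field_simp

open Real in
lemma case_ge_four (a : ℕ → ℂ) (k : ℕ) (σ : ℝ) (M : ℕ) (hM : 4 ≤ M)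
    (hs : Summable a) (ha : ∀ n, 2 ≤ n → ‖a n‖ = F k σ n) (ha0 : a 0 = 0) (ha1 : a 1 = 0)
    (h1 : ((M : ℝ) + 1) * log 3 ≤ σ - q M * k) (h2 : (M : ℝ) * log 3 ≤ q (M - 1) * k - σ) :
    ∑' n, a n ≠ 0 := by
  have hM' : (4 : ℝ) ≤ M := by exact_mod_cast hM
  have hF := F_pos k σ M
  have hL : 1 < log 3 := by have := log_three_gt_d9; linarith
  have hlogge : ∀ x y : ℝ, 0 < x → 0 < y → (x - y) / x ≤ log x - log y := by
    intro x y hx hy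
    have h := one_sub_inv_le_log_of_pos (x := x / y) (by positivity)
    rw [log_div (by positivity) (by positivity), inv_div] at h
    refine le_trans (le_of_eq ?_) h
    field_simp
  set c : ℝ := (5 * M + 4) / 3 * log 3 with hcdef
  have hcge : (5 * M + 4) / 3 ≤ c := le_mul_of_one_le_right (by positivity) hL.le
  have hcq : c ≤ σ - q (M + 1) * k := by
    have := mul_le_mul_of_nonneg_right (q_conv M hM) (Nat.cast_nonneg (α := ℝ) k)
    rw [hcdef]
    linarith
  have hα : F k σ (M + 1) ≤ 1 / 3 * F k σ M := by
    have h := F_up k σ _ M (M + 1) (by omega) (by omega) h1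
    push_cast at h
    refine h.trans ?_
    rw [mul_comm]
    apply mul_le_mul_of_nonneg_right _ hF.le
    rw [one_div, ← exp_log (show (0 : ℝ) < 3 by norm_num), ← exp_neg, exp_le_exp, neg_le_neg_iff,
      exp_log (by norm_num)]
    have := hlogge (M + 1) M (by linarith) (by linarith)
    rw [div_le_iff₀ (by linarith)] at this
    nlinarith
  have hρ : exp (-(c * (log ((M : ℝ) + 2) - log ((M : ℝ) + 1)))) ≤ 1 / 4 := by
    have h := hlogge (M + 2) (M + 1) (by linarith) (by linarith)
    have h43 : 4 / 3 * log 3 ≤ c * (log ((M : ℝ) + 2) - log ((M : ℝ) + 1)) := by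
      have hc0 : 0 ≤ c := by rw [hcdef]; positivity
      refine le_trans ?_ (mul_le_mul_of_nonneg_left h hc0)
      rw [hcdef, show ((M : ℝ) + 2 - (M + 1)) = 1 by ring, mul_one_div, le_div_iff₀ (by linarith)]
      nlinarith
    have h34 : log 4 ≤ 4 / 3 * log 3 := by
      have := log_le_log (by norm_num) (show (4 : ℝ) ^ 3 ≤ 3 ^ 4 by norm_num)
      rw [log_pow, log_pow] at this
      push_cast at this
      linarith
    rw [one_div, ← exp_log (show (0 : ℝ) < 4 by norm_num), ← exp_neg, exp_le_exp]
    linarith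
  have hpow : (0 : ℝ) < (3 ^ M : ℝ)⁻¹ := by positivity
  refine dominate a k σ M (by omega) (1 / 3) (1 / 12) (1 / 2 - (3 ^ M : ℝ)⁻¹ / 2) c hs ha ?_ hα
    (by linarith) (by norm_num) ?_ ?_
  · have hterm : ∀ n ∈ Finset.range M, ‖a n‖ ≤ F k σ M * (3 ^ M : ℝ)⁻¹ * 3 ^ n := by
      intro n hn
      have hn := Finset.mem_range.1 hn
      rcases Nat.lt_or_ge n 2 with h | h
      · have : a n = 0 := by interval_cases n <;> assumption
        rw [this, norm_zero]
        positivity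
      · rw [ha n h]
        obtain ⟨m, rfl⟩ : ∃ m, M = m + 1 := ⟨M - 1, by omega⟩
        have h3 := F_down k σ _ m n h (by omega) h2
        refine h3.trans ?_
        rw [mul_assoc (F k σ (m + 1))]
        apply mul_le_mul_of_nonneg_left _ hF.le
        have e : ((3 : ℝ) ^ (m + 1))⁻¹ * 3 ^ n = exp (-(((m : ℝ) + 1 - n) * log 3)) := by
          rw [show -(((m : ℝ) + 1 - n) * log 3) = -(((m + 1 : ℕ) : ℝ) * log 3) + (n : ℝ) * log 3 by
            push_cast; ring, exp_add, exp_neg, exp_nat_mul, exp_nat_mul, exp_log (by norm_num)]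
        rw [e, exp_le_exp, neg_le_neg_iff]
        have hn0 : (0 : ℝ) < n := by positivity
        have := hlogge ((m : ℝ) + 1) n (by positivity) hn0
        rw [div_le_iff₀ (by positivity)] at this
        push_cast
        nlinarith
    refine (Finset.sum_le_sum hterm).trans (le_of_eq ?_)
    rw [← Finset.mul_sum, geom_sum_eq (by norm_num)]
    field_simp
    ring
  · intro n hn
    have h := F_up k σ c (M + 1) n (by omega) (by omega) hcq
    have e : exp (-(c * (log (n : ℝ) - log ((M + 1 : ℕ) : ℝ)))) =
        exp (-(c * (log ((M : ℝ) + 2) - log ((M : ℝ) + 1)))) *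
          exp (-(c * (log (n : ℝ) - log ((M : ℝ) + 2)))) := by
      rw [← exp_add]
      push_cast
      congr 1
      ring
    rw [e] at h
    calc F k σ n ≤ _ := h
      _ ≤ (1 / 3 * F k σ M) * (1 / 4 * exp (-(c * (log (n : ℝ) - log ((M : ℝ) + 2))))) := by
        gcongr
      _ = _ := by ring
  · have : ((M : ℝ) + 2) / (c - 1) ≤ 1 := by
      rw [div_le_one (by linarith)]
      linarith
    linarith

open Real in
lemma q_nonneg (m : ℕ) (hm : 2 ≤ m) : 0 ≤ q m := by
  refine le_trans ?_ (q_lower m hm)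
  have h2 : (2 : ℝ) ≤ m := by exact_mod_cast hm
  have := log_nonneg (show (1 : ℝ) ≤ m by linarith)
  have := log_nonneg (show (1 : ℝ) ≤ (m : ℝ) + 1 by linarith)
  positivity

lemma logMul_iter (k n : ℕ) :
    (LSeries.logMul^[k] (1 : ℕ → ℂ)) n = (Complex.log n) ^ k := by
  induction k with
  | zero => simp
  | succ k ih =>
    rw [Function.iterate_succ_apply', LSeries.logMul, ih, pow_succ']

open Real in
lemma norm_term (k n : ℕ) (s : ℂ) (hn : 2 ≤ n) :
    ‖LSeries.term (LSeries.logMul^[k] (1 : ℕ → ℂ)) s n‖ = F k s.re n := by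
  have h2 : (2 : ℝ) ≤ n := by exact_mod_cast hn
  have hl : 0 < log (n : ℝ) := log_pos (by linarith)
  rw [LSeries.norm_term_eq, if_neg (by omega), logMul_iter, norm_pow, ← Complex.natCast_log,
    Complex.norm_real, norm_of_nonneg hl.le, F, exp_sub, exp_nat_mul, exp_log hl,
    rpow_def_of_pos (by linarith), mul_comm (log (n : ℝ))]

/-- For every integer `M ≥ 3`, every positive integer `k`, and every complex `s` with
`q M * k + (M+1) log 3 ≤ Re s ≤ q (M-1) * k - M log 3`, the `k`-th derivative of the
Riemann zeta function does not vanish at `s`. -/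
theorem zeta_deriv_ne_zero_general (M : ℕ) (hM : 3 ≤ M) (k : ℕ) (hk : 1 ≤ k) (s : ℂ)
    (h1 : q M * k + ((M : ℝ) + 1) * Real.log 3 ≤ s.re)
    (h2 : s.re ≤ q (M - 1) * k - (M : ℝ) * Real.log 3) :
    iteratedDeriv k riemannZeta s ≠ 0 := by
  have hL : 1 < Real.log 3 := by have := Real.log_three_gt_d9; linarith
  have hM' : (3 : ℝ) ≤ M := by exact_mod_cast hM
  have hq : 0 ≤ q M * k := mul_nonneg (q_nonneg M (by omega)) (Nat.cast_nonneg k)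
  have hs1 : 1 < s.re := by nlinarith
  have heq : riemannZeta =ᶠ[nhds s] LSeries 1 := by
    have : {z : ℂ | 1 < z.re} ∈ nhds s :=
      (isOpen_lt continuous_const Complex.continuous_re).mem_nhds hs1
    filter_upwards [this] with z hz
    exact (LSeries_one_eq_riemannZeta hz).symm
  have habs : LSeries.abscissaOfAbsConv (1 : ℕ → ℂ) < s.re := by
    rw [LSeries.abscissaOfAbsConv_one]
    exact_mod_cast hs1
  rw [heq.iteratedDeriv_eq k, LSeries_iteratedDeriv k habs]
  refine mul_ne_zero (pow_ne_zero _ (by norm_num)) ?_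
  have hsum : Summable (LSeries.term (LSeries.logMul^[k] (1 : ℕ → ℂ)) s) :=
    LSeriesSummable_of_abscissaOfAbsConv_lt_re (LSeries.absicssaOfAbsConv_logPowMul.symm ▸ habs)
  have hn := fun n hn => norm_term k n s hn
  have ha0 : LSeries.term (LSeries.logMul^[k] (1 : ℕ → ℂ)) s 0 = 0 := LSeries.term_zero ..
  have ha1 : LSeries.term (LSeries.logMul^[k] (1 : ℕ → ℂ)) s 1 = 0 := by
    rw [LSeries.term_of_ne_zero (by norm_num), logMul_iter]
    simp [show k ≠ 0 by omega]
  rw [LSeries]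
  rcases Nat.eq_or_lt_of_le hM with rfl | h4
  · refine case_three _ k s.re hsum hn ha0 ha1 ?_ ?_
    · push_cast at h1
      linarith
    · push_cast at h2
      linarith
  · exact case_ge_four _ k s.re M h4 hsum hn ha0 ha1 (by linarith) (by linarith)
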